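/- arXiv:2109.14999 — 2 statements merged into one kernel-verified Lean document; each statement's English description precedes it below -/
import Mathlib

section
/- Let N ≥ 2 and let z_{1,N} > z_{2,N} > ... > z_{N,N} be the ordered roots of the Hermite polynomial H_N. Then for every i ∈ {1,...,N−1}, z_{i,N} − z_{i+1,N} ≥ (2N)^{1/4}/(N−1)^{3/4} ≥ 2^{1/4}/(N−1)^{1/2}. -/
/-- The physicists' Hermite polynomials, orthogonal w.r.t. the weight `exp(-x²)` on `ℝ`:
`H_0 = 1`, `H_1 = 2X`, `H_{n+2} = 2X·H_{n+1} - 2(n+1)·H_n`. -/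
noncomputable def hermiteP : ℕ → Polynomial ℝ
  | 0 => 1
  | 1 => 2 * Polynomial.X
  | n + 2 => 2 * Polynomial.X * hermiteP (n + 1) - Polynomial.C (2 * ((n : ℝ) + 1)) * hermiteP n

open Polynomial in
theorem hermiteP_derivative_and_succ (n : ℕ) :
    derivative (hermiteP (n + 1)) = C (2 * ((n : ℝ) + 1)) * hermiteP n ∧
      hermiteP (n + 1) = 2 * X * hermiteP n - derivative (hermiteP n) := by
  induction n with
  | zero => constructor <;> simp [hermiteP, ← C_ofNat]
  | succ n ih =>
    obtain ⟨hd, hs⟩ := ih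
    have hrec : hermiteP (n + 2) =
        2 * X * hermiteP (n + 1) - C (2 * ((n : ℝ) + 1)) * hermiteP n := by rw [hermiteP]
    refine ⟨?_, by rw [hd, hrec]⟩
    have hd' : derivative (hermiteP n) = 2 * X * hermiteP n - hermiteP (n + 1) := by
      rw [hs]; ring
    rw [show n + 1 + 1 = n + 2 from rfl, hrec]
    simp only [derivative_sub, derivative_mul, derivative_X, derivative_ofNat, derivative_C,
      hd, hd']
    simp only [map_mul, map_add, map_ofNat, map_natCast, map_one, Nat.cast_add, Nat.cast_one]
    ring

open Polynomial in
/-- The Hermite differential equation `H_n'' - 2 x H_n' + 2 n H_n = 0`. -/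
theorem hermiteP_ode (n : ℕ) :
    derivative (derivative (hermiteP n)) =
      2 * X * derivative (hermiteP n) - C (2 * (n : ℝ)) * hermiteP n := by
  obtain ⟨hd, hs⟩ := hermiteP_derivative_and_succ n
  rw [hs] at hd
  simp only [derivative_sub, derivative_mul, derivative_X, derivative_ofNat] at hd
  simp only [map_mul, map_add, map_ofNat, map_natCast, map_one] at hd ⊢
  linear_combination -hd

open Polynomial in
theorem hermiteP_natDegree_le_and_coeff (n : ℕ) :
    (hermiteP n).natDegree ≤ n ∧ (hermiteP n).coeff n = 2 ^ n := by
  induction n using Nat.twoStepInduction with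
  | zero => simp [hermiteP]
  | one =>
    have h : hermiteP 1 = C 2 * X := by simp [hermiteP, ← C_ofNat]
    rw [h]
    exact ⟨(natDegree_C_mul_le _ _).trans natDegree_X_le, by simp⟩
  | more n ih₀ ih₁ =>
    have hrec : hermiteP (n + 2) =
        C 2 * (X * hermiteP (n + 1)) - C (2 * ((n : ℝ) + 1)) * hermiteP n := by
      rw [hermiteP, map_ofNat]; ring
    rw [hrec]
    constructor
    · refine (natDegree_sub_le _ _).trans (max_le ?_ ?_)
      · refine (natDegree_C_mul_le _ _).trans (natDegree_mul_le.trans ?_)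
        rw [natDegree_X]; omega
      · exact (natDegree_C_mul_le _ _).trans (by omega)
    · have h0 : (hermiteP n).coeff (n + 2) = 0 :=
        coeff_eq_zero_of_natDegree_lt (by omega)
      rw [coeff_sub, coeff_C_mul, coeff_C_mul, coeff_X_mul, h0, ih₁.2]
      ring

theorem hermiteP_natDegree (n : ℕ) : (hermiteP n).natDegree = n := by
  obtain ⟨hle, hc⟩ := hermiteP_natDegree_le_and_coeff n
  exact le_antisymm hle (Polynomial.le_natDegree_of_ne_zero (by rw [hc]; positivity))

theorem hermiteP_ne_zero (n : ℕ) : hermiteP n ≠ 0 := by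
  intro h
  have hc := (hermiteP_natDegree_le_and_coeff n).2
  rw [h, Polynomial.coeff_zero] at hc
  exact absurd hc.symm (by positivity)

open Polynomial in
theorem eq_C_mul_prod_X_sub_C {K : Type*} [Field K] {N : ℕ} {p : K[X]} (hp : p ≠ 0)
    (hdeg : p.natDegree = N) {z : Fin N → K} (hz : Function.Injective z)
    (hroot : ∀ i, p.eval (z i) = 0) :
    ∃ c : K, c ≠ 0 ∧ p = C c * ∏ i, (X - C (z i)) := by
  have hdvd : (∏ i, (X - C (z i))) ∣ p :=
    Finset.prod_dvd_of_coprime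
      (fun i _ j _ hij => pairwise_coprime_X_sub_C hz hij)
      (fun i _ => dvd_iff_isRoot.mpr (hroot i))
  obtain ⟨r, hr⟩ := hdvd
  have hr0 : r ≠ 0 := by rintro rfl; simp [hp] at hr
  have hmonic : (∏ i, (X - C (z i))).Monic := monic_prod_of_monic _ _ fun i _ => monic_X_sub_C _
  have hdr : r.natDegree = 0 := by
    have h := congrArg natDegree hr
    rw [hmonic.natDegree_mul' hr0, hdeg, natDegree_prod_of_monic _ _ fun i _ => monic_X_sub_C _] at h
    simpa using h
  obtain ⟨c, rfl⟩ := natDegree_eq_zero.mp hdr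
  exact ⟨c, by simpa using hr0, by rw [hr, mul_comm]⟩

open Polynomial in
theorem eval_derivatives_prod_X_sub_C {K ι : Type*} [Field K] (s : Finset ι) (z : ι → K) (x : K)
    (hx : ∀ j ∈ s, x - z j ≠ 0) :
    (derivative (∏ j ∈ s, (X - C (z j)))).eval x =
        (∏ j ∈ s, (X - C (z j))).eval x * ∑ j ∈ s, (x - z j)⁻¹ ∧
      (derivative (derivative (∏ j ∈ s, (X - C (z j))))).eval x =
        (∏ j ∈ s, (X - C (z j))).eval x *
          ((∑ j ∈ s, (x - z j)⁻¹) ^ 2 - ∑ j ∈ s, (x - z j)⁻¹ ^ 2) := by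
  classical
  induction s using Finset.induction_on with
  | empty => simp
  | insert a s ha ih =>
    have hxa := hx a (Finset.mem_insert_self a s)
    obtain ⟨h₁, h₂⟩ := ih fun j hj => hx j (Finset.mem_insert_of_mem hj)
    simp only [Finset.prod_insert ha, Finset.sum_insert ha, derivative_mul, derivative_add,
      derivative_sub, derivative_X, derivative_C, sub_zero, one_mul, eval_add, eval_mul, eval_sub,
      eval_X, eval_C, h₁, h₂]
    constructor
    · field_simp
    · field_simp
      ring

open Polynomial in
/-- The Stieltjes relations between the roots of the Hermite polynomial. -/
theorem hermiteP_roots_stieltjes {N : ℕ} {z : Fin N → ℝ} (hz : Function.Injective z)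
    (hroot : ∀ i, (hermiteP N).eval (z i) = 0) (i : Fin N) :
    ∑ j ∈ Finset.univ.erase i, (z i - z j)⁻¹ = z i ∧
      ∑ j ∈ Finset.univ.erase i, (z i - z j)⁻¹ ^ 2 = (2 * ((N : ℝ) - 1) - z i ^ 2) / 3 := by
  obtain ⟨c, hc, hH⟩ :=
    eq_C_mul_prod_X_sub_C (hermiteP_ne_zero N) (hermiteP_natDegree N) hz hroot
  have hne : ∀ j ∈ Finset.univ.erase i, z i - z j ≠ 0 := fun j hj =>
    sub_ne_zero.mpr fun h => (Finset.ne_of_mem_erase hj) (hz h).symm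
  obtain ⟨h₁, h₂⟩ := eval_derivatives_prod_X_sub_C (Finset.univ.erase i) z (z i) hne
  rw [← Finset.mul_prod_erase _ _ (Finset.mem_univ i)] at hH
  have hQ : (∏ j ∈ Finset.univ.erase i, (X - C (z j))).eval (z i) ≠ 0 := by
    rw [eval_prod]
    exact Finset.prod_ne_zero_iff.mpr fun j hj => by simpa using hne j hj
  generalize (∏ j ∈ Finset.univ.erase i, (X - C (z j))) = Q at *
  generalize ∑ j ∈ Finset.univ.erase i, (z i - z j)⁻¹ = S at *
  generalize ∑ j ∈ Finset.univ.erase i, (z i - z j)⁻¹ ^ 2 = T at *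
  have hode := hermiteP_ode N
  have e₁ := congrArg (eval (z i)) hode
  have e₂ := congrArg (fun p => eval (z i) (derivative p)) hode
  rw [hH] at e₁ e₂
  simp only [derivative_mul, derivative_add,
      derivative_sub, derivative_X, derivative_C, sub_zero, one_mul, eval_add, eval_mul, eval_sub,
      eval_X, eval_C, h₁, h₂, zero_mul, zero_add, sub_self, derivative_ofNat,
      eval_ofNat, mul_one, add_zero, mul_zero] at e₁ e₂
  have hS : S = z i := by
    have : c * eval (z i) Q * (S - z i) = 0 := by linear_combination e₁ / 2
    simpa [hc, hQ, sub_eq_zero] using this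
  refine ⟨hS, ?_⟩
  subst hS
  have : c * eval (z i) Q * (T - (2 * ((N : ℝ) - 1) - z i ^ 2) / 3) = 0 := by
    linear_combination -e₂ / 3
  simpa [hc, hQ, sub_eq_zero] using this

theorem hermiteP_roots_inv_sub_bound {N : ℕ} {z : Fin N → ℝ} (hz : Function.Injective z)
    (hroot : ∀ i, (hermiteP N).eval (z i) = 0) {i j : Fin N} (hij : i ≠ j) :
    (z i - (z i - z j)⁻¹) ^ 2 ≤
      ((N : ℝ) - 2) * ((2 * ((N : ℝ) - 1) - z i ^ 2) / 3 - (z i - z j)⁻¹ ^ 2) := by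
  obtain ⟨h₁, h₂⟩ := hermiteP_roots_stieltjes hz hroot i
  have hj : j ∈ Finset.univ.erase i := Finset.mem_erase.mpr ⟨hij.symm, Finset.mem_univ j⟩
  rw [← Finset.add_sum_erase _ _ hj] at h₁ h₂
  have hcard : (((Finset.univ.erase i).erase j).card : ℝ) = (N : ℝ) - 2 := by
    have hN : 2 ≤ N := by have := i.2; have := j.2; have := Fin.val_ne_of_ne hij; omega
    rw [Finset.card_erase_of_mem hj, Finset.card_erase_of_mem (Finset.mem_univ i),
      Finset.card_univ, Fintype.card_fin, Nat.sub_sub, Nat.cast_sub hN]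
    norm_num
  have hcs := sq_sum_le_card_mul_sum_sq (s := (Finset.univ.erase i).erase j)
    (f := fun k => (z i - z k)⁻¹)
  rw [hcard] at hcs
  rwa [eq_sub_of_add_eq' h₁, eq_sub_of_add_eq' h₂] at hcs

theorem two_mul_succ_le_pow_of_gap {n : ℕ} (hn : 1 ≤ n) {a b : ℝ} (hab : b < a)
    (ha : (a - (a - b)⁻¹) ^ 2 ≤ ((n : ℝ) - 1) * ((2 * n - a ^ 2) / 3 - (a - b)⁻¹ ^ 2))
    (hb : (b + (a - b)⁻¹) ^ 2 ≤ ((n : ℝ) - 1) * ((2 * n - b ^ 2) / 3 - (a - b)⁻¹ ^ 2)) :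
    2 * ((n : ℝ) + 1) ≤ (a - b) ^ 4 * n ^ 3 := by
  have hd : 0 < a - b := sub_pos.mpr hab
  have hn1 : (1 : ℝ) ≤ n := by exact_mod_cast hn
  have hu : (a - b) * (a - b)⁻¹ = 1 := mul_inv_cancel₀ hd.ne'
  generalize (a - b)⁻¹ = u at *
  obtain ⟨D, hD⟩ : ∃ D, D = (a - b) ^ 2 := ⟨_, rfl⟩
  have hD0 : 0 < D := by rw [hD]; positivity
  have hDu : D * u ^ 2 = 1 := by rw [hD]; linear_combination ((a - b) * u + 1) * hu
  have hsum : D / 4 - 1 + u ^ 2 ≤ ((n : ℝ) - 1) * ((2 * n - D / 4) / 3 - u ^ 2) := by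
    have hm : 0 ≤ ((n : ℝ) - 1 + 3) * (a + b) ^ 2 := by
      have := sq_nonneg (a + b)
      nlinarith
    subst hD
    linear_combination (ha + hb) / 2 + hm / 12 + hu
  have hkey : 3 * (D ^ 2 / 4 - D + 1) + ((n : ℝ) - 1) * (D ^ 2 / 4 + 3 - 2 * n * D) ≤ 0 := by
    have := mul_le_mul_of_nonneg_left hsum hD0.le
    linear_combination 3 * this - 3 * (n : ℝ) * hDu
  rw [show (a - b) ^ 4 = D ^ 2 by rw [hD]; ring]
  clear ha hb hsum hu hDu hD hd hab
  obtain rfl | rfl | h3 : n = 1 ∨ n = 2 ∨ 3 ≤ n := by omega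
  · norm_num at hkey ⊢
    have h : (D - 2) ^ 2 = 0 := le_antisymm (by linear_combination 4 / 3 * hkey) (sq_nonneg _)
    rw [sub_eq_zero.mp (pow_eq_zero_iff two_ne_zero |>.mp h)]
    norm_num
  · norm_num at hkey ⊢
    have h : 1 ≤ D := by
      by_contra! hlt
      have := mul_pos (sub_pos.mpr hlt) (by linarith : 0 < 6 - D)
      linarith
    nlinarith only [h]
  · have h3' : (3 : ℝ) ≤ n := by exact_mod_cast h3
    obtain ⟨t, ht, hnt⟩ : ∃ t : ℝ, 0 ≤ t ∧ (n : ℝ) = t + 3 := ⟨n - 3, by linarith, by ring⟩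
    rw [hnt] at hkey ⊢
    have hP : 0 < 2 * (t + 3) ^ 2 - 2 * (t + 3) + 3 := by nlinarith
    have hlin : 3 * (t + 3) ≤ D * (2 * (t + 3) ^ 2 - 2 * (t + 3) + 3) := by
      have : 0 ≤ (t + 5) * D ^ 2 := by positivity
      linear_combination hkey + this / 4
    have hsq : (3 * (t + 3)) ^ 2 ≤ (D * (2 * (t + 3) ^ 2 - 2 * (t + 3) + 3)) ^ 2 :=
      pow_le_pow_left₀ (by positivity) hlin 2
    have hpoly : 2 * (t + 3 + 1) * (2 * (t + 3) ^ 2 - 2 * (t + 3) + 3) ^ 2 ≤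
        (3 * (t + 3)) ^ 2 * (t + 3) ^ 3 := by
      rw [← sub_nonneg]
      ring_nf
      positivity
    refine le_of_mul_le_mul_right (hpoly.trans ?_) (pow_pos hP 2)
    calc (3 * (t + 3)) ^ 2 * (t + 3) ^ 3
        ≤ (D * (2 * (t + 3) ^ 2 - 2 * (t + 3) + 3)) ^ 2 * (t + 3) ^ 3 := by gcongr
      _ = _ := by ring

/-- For the ordered roots `z 0 > z 1 > … > z (N-1)` of the Hermite
polynomial `H_N` (`N ≥ 2`), consecutive roots satisfy
`z i - z (i+1) ≥ (2N)^{1/4}/(N-1)^{3/4} ≥ 2^{1/4}/(N-1)^{1/2}`. -/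
theorem hermite_roots_gap_ge
    (N : ℕ) (hN : 2 ≤ N) (z : Fin N → ℝ) (hz : StrictAnti z)
    (hroot : ∀ i, (hermiteP N).eval (z i) = 0) (i : ℕ) (hi : i + 1 < N) :
    (z ⟨i, Nat.lt_of_succ_lt hi⟩ - z ⟨i + 1, hi⟩
        ≥ (2 * (N : ℝ)) ^ ((1 : ℝ) / 4) / ((N : ℝ) - 1) ^ ((3 : ℝ) / 4))
      ∧ (2 * (N : ℝ)) ^ ((1 : ℝ) / 4) / ((N : ℝ) - 1) ^ ((3 : ℝ) / 4)
          ≥ (2 : ℝ) ^ ((1 : ℝ) / 4) / ((N : ℝ) - 1) ^ ((1 : ℝ) / 2) := by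
  have hinj := hz.injective
  have hlt : (⟨i, Nat.lt_of_succ_lt hi⟩ : Fin N) < ⟨i + 1, hi⟩ := Nat.lt_succ_self i
  obtain ⟨n, rfl⟩ : ∃ n, N = n + 1 := ⟨N - 1, by omega⟩
  have hn : 1 ≤ n := by omega
  have hn0 : (0 : ℝ) < n := by exact_mod_cast hn
  have ha := hermiteP_roots_inv_sub_bound hinj hroot hlt.ne
  have hb := hermiteP_roots_inv_sub_bound hinj hroot hlt.ne'
  have hab := hz hlt
  generalize z ⟨i, Nat.lt_of_succ_lt hi⟩ = a at *
  generalize z ⟨i + 1, hi⟩ = b at *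
  have hcast : ((n + 1 : ℕ) : ℝ) - 1 = n := by push_cast; ring
  have hcast' : ((n + 1 : ℕ) : ℝ) - 2 = (n : ℝ) - 1 := by push_cast; ring
  rw [hcast, hcast'] at ha hb
  rw [← neg_sub a b, inv_neg, sub_neg_eq_add, neg_sq] at hb
  have hgap := two_mul_succ_le_pow_of_gap hn hab ha hb
  have hd : 0 < a - b := sub_pos.mpr hab
  rw [hcast]
  push_cast
  constructor
  · rw [ge_iff_le, div_le_iff₀ (by positivity)]
    calc (2 * ((n : ℝ) + 1)) ^ ((1 : ℝ) / 4)
        ≤ ((a - b) ^ 4 * n ^ 3) ^ ((1 : ℝ) / 4) := by gcongr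
      _ = (a - b) * (n : ℝ) ^ ((3 : ℝ) / 4) := by
        rw [Real.mul_rpow (by positivity) (by positivity), ← Real.rpow_natCast (a - b),
          ← Real.rpow_natCast (n : ℝ), ← Real.rpow_mul hd.le, ← Real.rpow_mul hn0.le]
        norm_num
  · rw [ge_iff_le, div_le_div_iff₀ (by positivity) (by positivity)]
    calc (2 : ℝ) ^ ((1 : ℝ) / 4) * (n : ℝ) ^ ((3 : ℝ) / 4)
        = (2 * (n : ℝ)) ^ ((1 : ℝ) / 4) * (n : ℝ) ^ ((1 : ℝ) / 2) := by
          rw [Real.mul_rpow (by norm_num) hn0.le, mul_assoc, ← Real.rpow_add hn0]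
          norm_num
      _ ≤ (2 * ((n : ℝ) + 1)) ^ ((1 : ℝ) / 4) * (n : ℝ) ^ ((1 : ℝ) / 2) := by
          gcongr
          linarith
end

section
/- Let ν ≥ 1, N ≥ 2, and let z_{1,N} > ... > z_{N,N} > 0 be the ordered roots of the Laguerre polynomial L_N^{(ν−1)}. Assume the lower bound z_{N,N} ≥ (ν² − 1)/(4(N + ν/2)) for the smallest root. Then for every i ∈ {1,...,N−1}, z_{i,N} − z_{i+1,N} ≥ (sqrt(2)/(2N−1)) · sqrt( 2 + sqrt(2)·sqrt( 2 + (2N−1)²(ν²−1)²/(N+ν/2)² ) ) ≥ 2^{3/4}·sqrt(ν²−1)/sqrt((2N−1)(N+ν/2)). -/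
/-- The generalized Laguerre polynomials `L_n^{(a)}`, orthogonal w.r.t. the weight
`exp(-x)·x^a` on `(0,∞)` (for `a > -1`), defined via the standard three-term recurrence
`L_0^{(a)} = 1`, `L_1^{(a)} = 1 + a - X`,
`(n+2)·L_{n+2}^{(a)} = (2(n+1)+1+a-X)·L_{n+1}^{(a)} - (n+1+a)·L_n^{(a)}`. -/
noncomputable def laguerreP (a : ℝ) : ℕ → Polynomial ℝ
  | 0 => 1
  | 1 => Polynomial.C (1 + a) - Polynomial.X
  | n + 2 =>
      Polynomial.C (1 / ((n : ℝ) + 2)) *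
        ((Polynomial.C (2 * ((n : ℝ) + 1) + 1 + a) - Polynomial.X) * laguerreP a (n + 1)
          - Polynomial.C (((n : ℝ) + 1) + a) * laguerreP a n)

open Polynomial in
theorem laguerreP_add_two (a : ℝ) (n : ℕ) :
    C ((n : ℝ) + 2) * laguerreP a (n + 2)
      = (C (2 * ((n : ℝ) + 1) + 1 + a) - X) * laguerreP a (n + 1)
        - C ((n : ℝ) + 1 + a) * laguerreP a n := by
  have h : ((n : ℝ) + 2) * (1 / ((n : ℝ) + 2)) = 1 := by field_simp
  rw [laguerreP, ← mul_assoc, ← C_mul, h, C_1, one_mul]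

open Polynomial in
theorem derivative_laguerreP_succ (a : ℝ) (n : ℕ) :
    X * derivative (laguerreP a (n + 1))
        = C ((n : ℝ) + 1) * laguerreP a (n + 1) - C ((n : ℝ) + 1 + a) * laguerreP a n
      ∧ derivative (laguerreP a (n + 1)) = derivative (laguerreP a n) - laguerreP a n := by
  induction n with
  | zero => constructor <;> simp [laguerreP]
  | succ n ih =>
    obtain ⟨h₁, h₂⟩ := ih
    have hr := laguerreP_add_two a n
    have hd := congrArg derivative hr
    have hn : C ((n : ℝ) + 2) ≠ 0 := C_ne_zero.mpr (by positivity)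
    simp only [derivative_mul, derivative_sub, derivative_C, derivative_X] at hd
    have h : derivative (laguerreP a (n + 2))
        = derivative (laguerreP a (n + 1)) - laguerreP a (n + 1) := by
      apply mul_left_cancel₀ hn
      simp only [C_add, C_mul, map_ofNat, C_1] at *
      linear_combination hd + (C (n : ℝ) + 1 + C a) * h₂ - h₁
    refine ⟨?_, h⟩
    rw [h]
    push_cast
    simp only [C_add, C_mul, map_ofNat, C_1] at *
    linear_combination h₁ - hr

open Polynomial in
/-- The Laguerre differential equation. -/
theorem laguerreP_ode (a : ℝ) (n : ℕ) :
    X * derivative (derivative (laguerreP a n)) + (C (a + 1) - X) * derivative (laguerreP a n)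
      + C (n : ℝ) * laguerreP a n = 0 := by
  cases n with
  | zero => simp [laguerreP]
  | succ n =>
    obtain ⟨h₁, h₂⟩ := derivative_laguerreP_succ a n
    have hd := congrArg derivative h₁
    simp only [derivative_mul, derivative_sub, derivative_C, derivative_X] at hd
    push_cast
    simp only [C_add, C_1] at *
    linear_combination hd + (C (n : ℝ) + 1 + C a) * h₂ - h₁

open Polynomial in
theorem natDegree_laguerreP_le (a : ℝ) : ∀ n, (laguerreP a n).natDegree ≤ n
  | 0 => by simp [laguerreP]
  | 1 => by
    rw [laguerreP]
    compute_degree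
  | n + 2 => by
    have h₁ := natDegree_laguerreP_le a (n + 1)
    have h₀ := natDegree_laguerreP_le a n
    rw [laguerreP]
    refine (natDegree_C_mul_le _ _).trans ((natDegree_sub_le _ _).trans (max_le ?_ ?_))
    · have h : (C (2 * ((n : ℝ) + 1) + 1 + a) - X).natDegree ≤ 1 := by compute_degree
      exact natDegree_mul_le.trans (by omega)
    · exact (natDegree_C_mul_le _ _).trans (by omega)

theorem eval_zero_laguerreP_pos {a : ℝ} (ha : 0 ≤ a) (n : ℕ) : 0 < (laguerreP a n).eval 0 := by
  induction n with
  | zero => simp [laguerreP]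
  | succ n ih =>
    have h := congrArg (Polynomial.eval 0) (derivative_laguerreP_succ a n).1
    simp only [Polynomial.eval_mul, Polynomial.eval_sub, Polynomial.eval_X,
      Polynomial.eval_C, zero_mul] at h
    have h' : 0 < ((n : ℝ) + 1 + a) * (laguerreP a n).eval 0 := by positivity
    exact pos_of_mul_pos_right (by linarith : 0 < ((n : ℝ) + 1) * (laguerreP a (n + 1)).eval 0)
      (by positivity)

open Polynomial in
/-- A polynomial with as many distinct roots as its degree bound is a multiple of the product
of the corresponding linear factors. -/
theorem exists_eq_C_mul_prod_of_injective {N : ℕ} {p : ℝ[X]} (hp : p ≠ 0)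
    (hdeg : p.natDegree ≤ N) {z : Fin N → ℝ} (hz : Function.Injective z)
    (hroot : ∀ i, p.eval (z i) = 0) :
    ∃ c : ℝ, c ≠ 0 ∧ p = C c * ∏ i, (X - C (z i)) := by
  have hdvd : (∏ i, (X - C (z i))) ∣ p :=
    Finset.prod_dvd_of_coprime
      (fun i _ j _ hij => pairwise_coprime_X_sub_C hz hij)
      (fun i _ => dvd_iff_isRoot.mpr (hroot i))
  obtain ⟨q, rfl⟩ := hdvd
  have hq : q ≠ 0 := right_ne_zero_of_mul hp
  rw [natDegree_mul (left_ne_zero_of_mul hp) hq, natDegree_prod_of_monic _ _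
    (fun i _ => monic_X_sub_C _)] at hdeg
  simp only [natDegree_X_sub_C, Finset.sum_const, Finset.card_univ, Fintype.card_fin,
    smul_eq_mul, mul_one] at hdeg
  have hq0 := eq_C_of_natDegree_eq_zero (show q.natDegree = 0 by omega)
  refine ⟨q.coeff 0, fun h => hq (by rw [hq0, h, C_0]), ?_⟩
  rw [← hq0, mul_comm]

open Polynomial in
theorem eval_laguerreInequality_X_sub_C_mul (p : ℝ[X]) (a x : ℝ) :
    (derivative ((X - C a) * p)).eval x ^ 2
        - ((X - C a) * p).eval x * (derivative (derivative ((X - C a) * p))).eval x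
      = (x - a) ^ 2 * ((derivative p).eval x ^ 2
          - p.eval x * (derivative (derivative p)).eval x) + p.eval x ^ 2 := by
  simp
  ring

open Polynomial in
/-- The Laguerre inequality `p'² - p p'' ≥ 0` for a product of real linear factors. -/
theorem laguerreInequality_prod {ι : Type*} (s : Finset ι) (z : ι → ℝ) (c x : ℝ) :
    0 ≤ (derivative (C c * ∏ i ∈ s, (X - C (z i)))).eval x ^ 2
        - (C c * ∏ i ∈ s, (X - C (z i))).eval x
          * (derivative (derivative (C c * ∏ i ∈ s, (X - C (z i))))).eval x := by
  classical
  induction s using Finset.induction_on with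
  | empty => simp
  | insert i s hi ih =>
    rw [Finset.prod_insert hi, mul_left_comm, eval_laguerreInequality_X_sub_C_mul]
    positivity

open Polynomial in
/-- The gap between two roots of a Laguerre polynomial, bounded below uniformly. -/
theorem laguerreP_sq_gap_ge {ν : ℝ} (hν : 1 ≤ ν) {N : ℕ} {z : Fin N → ℝ}
    (hz : Function.Injective z) (hpos : ∀ i, 0 < z i)
    (hroot : ∀ i, (laguerreP (ν - 1) N).eval (z i) = 0) {i j : Fin N} (hij : i ≠ j) :
    3 * (ν * (ν + 4)) ≤ ((N : ℝ) ^ 2 + N * ν - ν) * (z i - z j) ^ 2 := by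
  have hp : laguerreP (ν - 1) N ≠ 0 := fun h => by
    have := eval_zero_laguerreP_pos (sub_nonneg.mpr hν) N
    simp [h] at this
  obtain ⟨c, hc, hprod⟩ := exists_eq_C_mul_prod_of_injective hp (natDegree_laguerreP_le _ _) hz hroot
  set s := (Finset.univ.erase i).erase j with hs
  set g := C c * ∏ k ∈ s, (X - C (z k)) with hg
  have hfac : laguerreP (ν - 1) N = (X - C (z i)) * ((X - C (z j)) * g) := by
    rw [hprod, ← Finset.mul_prod_erase _ _ (Finset.mem_univ i),
      ← Finset.mul_prod_erase (Finset.univ.erase i) _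
        (Finset.mem_erase.mpr ⟨hij.symm, Finset.mem_univ j⟩), hg]
    ring
  have hgx : g.eval (z i) ≠ 0 := by
    rw [hg, eval_mul, eval_C, eval_prod]
    refine mul_ne_zero hc (Finset.prod_ne_zero_iff.mpr fun k hk => ?_)
    have hk' : k ≠ i := (Finset.mem_erase.mp (Finset.mem_erase.mp hk).2).1
    simpa [sub_eq_zero] using fun h => hk' (hz h).symm
  have hgap : z i - z j ≠ 0 := sub_ne_zero.mpr fun h => hij (hz h)
  have hF := laguerreInequality_prod s z c (z i)
  rw [← hg] at hF
  have hFr := eval_laguerreInequality_X_sub_C_mul g (z j) (z i)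
  have hr : ((X - C (z j)) * g).eval (z i) = (z i - z j) * g.eval (z i) := by simp
  have hode := laguerreP_ode (ν - 1) N
  rw [hfac] at hode
  generalize (X - C (z j)) * g = r at hFr hr hode
  have hode' := congrArg (fun p => (derivative p).eval (z i)) hode
  replace hode := congrArg (eval (z i)) hode
  simp at hode hode'
  have hx := hpos i
  generalize z i = x at *
  generalize z j = y at *
  generalize eval x r = r₀ at *
  generalize eval x (derivative r) = r₁ at *
  generalize eval x (derivative (derivative r)) = r₂ at *
  generalize eval x g = g₀ at *
  have hr₀ : 0 < r₀ ^ 2 := by rw [hr]; positivity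
  have hle : r₀ ^ 2 ≤ (x - y) ^ 2 * (r₁ ^ 2 - r₀ * r₂) := by
    rw [hFr, hr]
    have := mul_nonneg (sq_nonneg (x - y)) (mul_nonneg (sq_nonneg (x - y)) hF)
    linarith
  have hS : 12 * x ^ 2 * (r₁ ^ 2 - r₀ * r₂)
      = r₀ ^ 2 * (-x ^ 2 + (2 * ν + 4 * N) * x - ν * (ν + 4)) := by
    linear_combination (3 * (2 * x * r₁ - (ν - x) * r₀) + 4 * r₀ * (ν + 1 - x)) * hode
      - 4 * x * r₀ * hode'
  have h12 : 12 * x ^ 2 ≤ (x - y) ^ 2 * (-x ^ 2 + (2 * ν + 4 * N) * x - ν * (ν + 4)) := by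
    refine le_of_mul_le_mul_left ?_ hr₀
    have := mul_le_mul_of_nonneg_left hle (by positivity : 0 ≤ 12 * x ^ 2)
    calc _ = 12 * x ^ 2 * r₀ ^ 2 := by ring
      _ ≤ _ := this
      _ = (x - y) ^ 2 * (12 * x ^ 2 * (r₁ ^ 2 - r₀ * r₂)) := by ring
      _ = _ := by rw [hS]; ring
  have hA : 0 ≤ ν * (ν + 4) := by positivity
  refine le_of_mul_le_mul_left ?_ (by positivity : 0 < 4 * x ^ 2)
  have h₁ := mul_le_mul_of_nonneg_left h12 hA
  have h₂ := mul_nonneg (sq_nonneg (x - y)) (sq_nonneg ((ν + 2 * N) * x - ν * (ν + 4)))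
  linarith

/-- A uniform lower bound for `d ^ 2` implies the explicit lower bound for `d`. -/
theorem gap_bound_le_of_sq {ν n d : ℝ} (hν : 1 ≤ ν) (hn : 2 ≤ n) (hd : 0 < d)
    (h : 3 * (ν * (ν + 4)) ≤ (n ^ 2 + n * ν - ν) * d ^ 2) :
    Real.sqrt 2 / (2 * n - 1) *
        Real.sqrt (2 + Real.sqrt 2 *
          Real.sqrt (2 + (2 * n - 1) ^ 2 * (ν ^ 2 - 1) ^ 2 / (n + ν / 2) ^ 2)) ≤ d := by
  have hm : 0 < 2 * n - 1 := by linarith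
  have hM : 0 < n + ν / 2 := by linarith
  have hB : 0 ≤ ν ^ 2 - 1 := by nlinarith
  have hD : 0 < n ^ 2 + n * ν - ν := by nlinarith
  have hA : 0 < ν * (ν + 4) := by positivity
  have hDM : n ^ 2 + n * ν - ν ≤ (2 * n - 1) * (n + ν / 2) := by nlinarith
  have hpoly : 24 * (n ^ 2 + n * ν - ν) ≤ (2 * n - 1) ^ 2 * (ν * (ν + 4) + 32 * ν + 8) := by
    have h₁ : n ^ 2 ≤ (2 * n - 1) ^ 2 := by nlinarith
    have h₂ : n * ν ≤ n ^ 2 * ν := by nlinarith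
    nlinarith [mul_le_mul_of_nonneg_right h₁ (by positivity : 0 ≤ ν * (ν + 4) + 32 * ν + 8)]
  have hAB : ν * (ν + 4) * (ν * (ν + 4) + 32 * ν + 8)
      ≤ 9 * (ν * (ν + 4)) ^ 2 - 8 * (ν ^ 2 - 1) ^ 2 := by nlinarith [mul_nonneg hB hB]
  set m := 2 * n - 1
  set M := n + ν / 2
  set A := ν * (ν + 4)
  set B := ν ^ 2 - 1
  set D := n ^ 2 + n * ν - ν
  have hH : 3 * A / D ≤ d ^ 2 := by rw [div_le_iff₀ hD]; linarith
  have hquad : 8 * (3 * A / D) + 8 * (B ^ 2 / M ^ 2) ≤ m ^ 2 * (3 * A / D) ^ 2 := by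
    have hw : B ^ 2 / M ^ 2 ≤ m ^ 2 * B ^ 2 / D ^ 2 := by
      rw [div_le_div_iff₀ (by positivity) (by positivity)]
      have := mul_le_mul_of_nonneg_left (pow_le_pow_left₀ hD.le hDM 2) (sq_nonneg B)
      linarith
    have h₀ : 24 * A * D + 8 * (m ^ 2 * B ^ 2) ≤ 9 * m ^ 2 * A ^ 2 := by
      have h₁ := mul_le_mul_of_nonneg_left hpoly hA.le
      have h₂ := mul_le_mul_of_nonneg_left hAB (sq_nonneg m)
      linarith
    calc _ ≤ 8 * (3 * A / D) + 8 * (m ^ 2 * B ^ 2 / D ^ 2) := by gcongr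
      _ = (24 * A * D + 8 * (m ^ 2 * B ^ 2)) / D ^ 2 := by field_simp; ring
      _ ≤ 9 * m ^ 2 * A ^ 2 / D ^ 2 := by gcongr
      _ = _ := by field_simp; norm_num
  have hHpos : 0 < 3 * A / D := by positivity
  set H := 3 * A / D
  have hH4 : 4 ≤ m ^ 2 * H := by
    refine le_of_mul_le_mul_right ?_ hHpos
    have : 0 ≤ B ^ 2 / M ^ 2 := by positivity
    nlinarith
  have hsqrt : Real.sqrt 2 * Real.sqrt (2 + m ^ 2 * B ^ 2 / M ^ 2) ≤ m ^ 2 * H / 2 - 2 := by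
    rw [← Real.sqrt_mul (by norm_num)]
    refine Real.sqrt_le_iff.mpr ⟨by linarith, ?_⟩
    have := mul_le_mul_of_nonneg_left hquad (sq_nonneg m)
    rw [mul_div_assoc]
    nlinarith
  refine abs_le_of_sq_le_sq' ?_ hd.le |>.2
  rw [mul_pow, div_pow, Real.sq_sqrt (by norm_num), Real.sq_sqrt (by positivity)]
  calc _ ≤ 2 / m ^ 2 * (2 + (m ^ 2 * H / 2 - 2)) := by gcongr
    _ = H := by field_simp; ring
    _ ≤ _ := hH

theorem two_rpow_mul_sqrt_div_sqrt_le {m M B : ℝ} (hm : 0 < m) (hM : 0 < M) (hB : 0 ≤ B) :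
    (2 : ℝ) ^ ((3 : ℝ) / 4) * Real.sqrt B / Real.sqrt (m * M)
      ≤ Real.sqrt 2 / m *
        Real.sqrt (2 + Real.sqrt 2 * Real.sqrt (2 + m ^ 2 * B ^ 2 / M ^ 2)) := by
  have hpow : ((2 : ℝ) ^ ((3 : ℝ) / 4)) ^ 2 = 2 * Real.sqrt 2 := by
    rw [Real.sqrt_eq_rpow, ← Real.rpow_natCast, ← Real.rpow_mul (by norm_num)]
    nth_rewrite 2 [← Real.rpow_one 2]
    rw [← Real.rpow_add (by norm_num)]
    norm_num
  have hroot : m * B / M ≤ Real.sqrt (2 + m ^ 2 * B ^ 2 / M ^ 2) := by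
    refine Real.le_sqrt_of_sq_le ?_
    rw [div_pow, mul_pow]
    linarith
  refine abs_le_of_sq_le_sq' ?_ (by positivity) |>.2
  rw [div_pow, mul_pow, mul_pow, div_pow, hpow, Real.sq_sqrt hB, Real.sq_sqrt (by positivity),
    Real.sq_sqrt (by norm_num), Real.sq_sqrt (by positivity)]
  calc _ = 2 / m ^ 2 * (0 + Real.sqrt 2 * (m * B / M)) := by field_simp; ring
    _ ≤ _ := by gcongr; norm_num

/-- For the ordered roots `z 0 > … > z (N-1) > 0` of the Laguerre
polynomial `L_N^{(ν-1)}` (`ν ≥ 1`, `N ≥ 2`), assuming the classical lower bound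
`z (N-1) ≥ (ν²-1)/(4(N+ν/2))` for the smallest root, consecutive roots satisfy
`z i - z (i+1) ≥ (√2/(2N-1))·√(2 + √2·√(2 + (2N-1)²(ν²-1)²/(N+ν/2)²))
   ≥ 2^{3/4}·√(ν²-1)/√((2N-1)(N+ν/2))`. -/
theorem laguerre_roots_gap_ge_of_smallest_root_bound
    (ν : ℝ) (hν : 1 ≤ ν) (N : ℕ) (hN : 2 ≤ N) (z : Fin N → ℝ)
    (hz : StrictAnti z) (hpos : ∀ i, 0 < z i)
    (hroot : ∀ i, (laguerreP (ν - 1) N).eval (z i) = 0)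
    (hlow : z ⟨N - 1, Nat.sub_lt (by omega) one_pos⟩
      ≥ (ν ^ 2 - 1) / (4 * ((N : ℝ) + ν / 2)))
    (i : ℕ) (hi : i + 1 < N) :
    (z ⟨i, Nat.lt_of_succ_lt hi⟩ - z ⟨i + 1, hi⟩
        ≥ Real.sqrt 2 / (2 * (N : ℝ) - 1) *
            Real.sqrt (2 + Real.sqrt 2 *
              Real.sqrt (2 + (2 * (N : ℝ) - 1) ^ 2 * (ν ^ 2 - 1) ^ 2
                / ((N : ℝ) + ν / 2) ^ 2)))
      ∧ Real.sqrt 2 / (2 * (N : ℝ) - 1) *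
            Real.sqrt (2 + Real.sqrt 2 *
              Real.sqrt (2 + (2 * (N : ℝ) - 1) ^ 2 * (ν ^ 2 - 1) ^ 2
                / ((N : ℝ) + ν / 2) ^ 2))
          ≥ (2 : ℝ) ^ ((3 : ℝ) / 4) * Real.sqrt (ν ^ 2 - 1)
              / Real.sqrt ((2 * (N : ℝ) - 1) * ((N : ℝ) + ν / 2)) := by
  have hN' : (2 : ℝ) ≤ N := by exact_mod_cast hN
  set n : ℝ := (N : ℝ) with hn
  have hm : 0 < 2 * n - 1 := by linarith
  have hB : 0 ≤ ν ^ 2 - 1 := by nlinarith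
  have hM : 0 < n + ν / 2 := by linarith
  constructor
  · have hlt : z ⟨i + 1, hi⟩ < z ⟨i, Nat.lt_of_succ_lt hi⟩ := hz (by simp [Fin.lt_def])
    have hgap := laguerreP_sq_gap_ge hν hz.injective hpos hroot
      (i := ⟨i, Nat.lt_of_succ_lt hi⟩) (j := ⟨i + 1, hi⟩) (by simp)
    exact gap_bound_le_of_sq hν hN' (sub_pos.mpr hlt) hgap
  · exact two_rpow_mul_sqrt_div_sqrt_le hm hM hB
end
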